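/- arXiv:2002.00611 — 8 statements merged into one kernel-verified Lean document; each statement's English description precedes it below -/
import Mathlib

section
/- The function V(τ) = (τ/γ)(2^{D/(Wτ)} − 1) is strictly decreasing on (0, ∞); that is, for all real numbers τ₁, τ₂ with 0 < τ₁ < τ₂, one has V(τ₁) > V(τ₂). -/
/-- For fixed D, W, γ > 0, the function
`V(τ) = (τ/γ)(2^{D/(Wτ)} − 1)` is strictly decreasing on (0, ∞):
for all real τ₁, τ₂ with 0 < τ₁ < τ₂ one has V(τ₁) > V(τ₂). -/
theorem V_strict_decreasing (D W γ : ℝ) (hD : 0 < D) (hW : 0 < W) (hγ : 0 < γ)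
    (V : ℝ → ℝ) (hV : ∀ τ : ℝ, V τ = (τ / γ) * ((2 : ℝ) ^ (D / (W * τ)) - 1)) :
    ∀ τ₁ τ₂ : ℝ, 0 < τ₁ → τ₁ < τ₂ → V τ₂ < V τ₁ := by
  intro τ₁ τ₂ h₁ h₁₂
  have h₂ : 0 < τ₂ := h₁.trans h₁₂
  have hs : 1 < (2 : ℝ) ^ (D / (W * τ₂)) :=
    Real.one_lt_rpow one_lt_two (by positivity)
  have hB := one_add_mul_self_lt_rpow_one_add (s := (2 : ℝ) ^ (D / (W * τ₂)) - 1)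
    (by linarith) (by linarith) ((one_lt_div h₁).2 h₁₂)
  have hexp : D / (W * τ₂) * (τ₂ / τ₁) = D / (W * τ₁) := by field_simp
  rw [add_sub_cancel, ← Real.rpow_mul zero_le_two, hexp, ← lt_sub_iff_add_lt',
    div_mul_eq_mul_div, div_lt_iff₀' h₁] at hB
  rw [hV, hV, div_mul_eq_mul_div, div_mul_eq_mul_div]
  exact div_lt_div_of_pos_right hB hγ
end

section
/- For every real number τ₀ with τ₀ > D·ln 2/(W·γ), there exists a unique τ > 0 such that V(τ) = τ₀; in other words, V is a bijection from (0, ∞) onto the interval (D·ln 2/(W·γ), ∞). -/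
/-- The secant slope `(exp x - 1) / x` is a bijection from `(0, ∞)` onto `(1, ∞)`. -/
theorem bijOn_exp_sub_one_div :
    Set.BijOn (fun x : ℝ => (Real.exp x - 1) / x) (Set.Ioi 0) (Set.Ioi 1) := by
  refine ⟨fun x hx => ?_, StrictMonoOn.injOn fun x hx y hy hxy => ?_, fun y hy => ?_⟩
  · have hx : 0 < x := hx
    rw [Set.mem_Ioi, one_lt_div hx]
    linarith [Real.add_one_lt_exp hx.ne']
  · simpa using strictConvexOn_exp.secant_strict_mono (Set.mem_univ 0) (Set.mem_univ x)
      (Set.mem_univ y) (ne_of_gt hx) (ne_of_gt hy) hxy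
  · have hy : 1 < y := hy
    have hy0 : 0 < y := by linarith
    have hlog : 0 < Real.log y := Real.log_pos hy
    have hle : Real.log y ≤ 2 * y := by linarith [Real.log_le_sub_one_of_pos hy0]
    have hcont : ContinuousOn (fun x : ℝ => Real.exp x - 1 - y * x)
        (Set.Icc (Real.log y) (2 * y)) := by fun_prop
    have hlow : Real.exp (Real.log y) - 1 - y * Real.log y ≤ 0 := by
      rw [Real.exp_log hy0]
      have h := mul_le_mul_of_nonneg_left (Real.one_sub_inv_le_log_of_pos hy0) hy0.le
      rw [mul_sub, mul_inv_cancel₀ hy0.ne'] at h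
      linarith
    have hhigh : 0 ≤ Real.exp (2 * y) - 1 - y * (2 * y) := by
      nlinarith [Real.quadratic_le_exp_of_nonneg (by positivity : 0 ≤ 2 * y)]
    obtain ⟨x, hx, hxy⟩ := intermediate_value_Icc hle hcont ⟨hlow, hhigh⟩
    have hx0 : 0 < x := hlog.trans_le hx.1
    refine ⟨x, hx0, ?_⟩
    simp only at hxy ⊢
    rw [div_eq_iff hx0.ne']
    linarith

/-- For every τ₀ > D·ln 2/(W·γ) there is a unique τ > 0 with V(τ) = τ₀;
in other words V is a bijection from (0,∞) onto (D·ln 2/(W·γ), ∞). -/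
theorem V_bijection (D W γ : ℝ) (hD : 0 < D) (hW : 0 < W) (hγ : 0 < γ)
    (V : ℝ → ℝ) (hV : ∀ τ : ℝ, V τ = (τ / γ) * ((2 : ℝ) ^ (D / (W * τ)) - 1)) :
    (∀ τ₀ : ℝ, D * Real.log 2 / (W * γ) < τ₀ → ∃! τ : ℝ, 0 < τ ∧ V τ = τ₀) ∧
    Set.BijOn V (Set.Ioi (0 : ℝ)) (Set.Ioi (D * Real.log 2 / (W * γ))) := by
  have hlog : 0 < Real.log 2 := Real.log_pos one_lt_two
  set a := D * Real.log 2 / W with ha_def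
  set c := D * Real.log 2 / (W * γ) with hc_def
  have ha : 0 < a := by positivity
  have hc : 0 < c := by positivity
  have hinv : Set.BijOn (fun τ : ℝ => a / τ) (Set.Ioi 0) (Set.Ioi 0) :=
    Set.InvOn.bijOn (f' := fun τ : ℝ => a / τ)
      ⟨fun τ _ => div_div_cancel₀ ha.ne', fun τ _ => div_div_cancel₀ ha.ne'⟩
      (fun τ hτ => div_pos ha hτ) (fun τ hτ => div_pos ha hτ)
  have hmul : Set.BijOn (fun y : ℝ => c * y) (Set.Ioi 1) (Set.Ioi c) := by
    refine Set.InvOn.bijOn (f' := fun z : ℝ => z / c)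
      ⟨fun y _ => mul_div_cancel_left₀ y hc.ne', fun z _ => mul_div_cancel₀ z hc.ne'⟩
      (fun y hy => lt_mul_of_one_lt_right hc hy) (fun z hz => (one_lt_div hc).2 hz)
  have hbij : Set.BijOn V (Set.Ioi 0) (Set.Ioi c) := by
    refine (hmul.comp (bijOn_exp_sub_one_div.comp hinv)).congr fun τ hτ => ?_
    have hτ : 0 < τ := hτ
    have hexp : Real.log 2 * (D / (W * τ)) = a / τ := by
      rw [ha_def]
      field_simp
    simp only [Function.comp_apply]
    rw [hV, Real.rpow_def_of_pos two_pos, hexp]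
    generalize Real.exp (a / τ) = e
    rw [ha_def, hc_def]
    field_simp
  refine ⟨fun τ₀ hτ₀ => ?_, hbij⟩
  obtain ⟨τ, hτ, hVτ⟩ := hbij.surjOn hτ₀
  exact ⟨τ, ⟨hτ, hVτ⟩, fun σ hσ => hbij.injOn hσ.1 hτ (hσ.2.trans hVτ.symm)⟩
end

section
/- Let F : (D·ln 2/(W·γ), ∞) → (0, ∞) be the inverse of V, i.e., for each τ₀ > D·ln 2/(W·γ), F(τ₀) is the unique τ > 0 with V(τ) = τ₀. Then F is strictly decreasing and convex on (D·ln 2/(W·γ), ∞). -/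
/-- The perspective `x ↦ x (exp (c / x) - 1)` has a supporting line of negative slope at each
point of `(0, ∞)`. -/
theorem exists_neg_slope_le_mul_exp_div_sub_one {c t : ℝ} (hc : 0 < c) (ht : 0 < t) :
    ∃ m < 0, ∀ x > 0,
      t * (Real.exp (c / t) - 1) + m * (x - t) ≤ x * (Real.exp (c / x) - 1) := by
  refine ⟨Real.exp (c / t) * (1 - c / t) - 1, ?_, fun x hx => ?_⟩
  · have h := Real.add_one_lt_exp (x := -(c / t)) (neg_ne_zero.mpr (by positivity))
    have h' := mul_lt_mul_of_pos_left h (Real.exp_pos (c / t))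
    rw [← Real.exp_add, add_neg_cancel, Real.exp_zero] at h'
    linarith
  · have h := mul_le_mul_of_nonneg_left (Real.add_one_le_exp (c / x - c / t))
      (mul_pos hx (Real.exp_pos (c / t))).le
    have e : x * Real.exp (c / t) * Real.exp (c / x - c / t) = x * Real.exp (c / x) := by
      rw [mul_assoc, ← Real.exp_add, add_sub_cancel]
    have e' : x * Real.exp (c / t) * (c / x - c / t + 1) =
        t * Real.exp (c / t) + Real.exp (c / t) * (1 - c / t) * (x - t) := by
      field_simp
      ring
    linarith

/-- Let F be the inverse of V on (D·ln 2/(W·γ), ∞), i.e. for each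
τ₀ > D·ln 2/(W·γ), F(τ₀) is the unique τ > 0 with V(τ) = τ₀. Then F is strictly
decreasing and convex on (D·ln 2/(W·γ), ∞). -/
theorem V_inverse_antitone_convex (D W γ : ℝ) (hD : 0 < D) (hW : 0 < W) (hγ : 0 < γ)
    (V : ℝ → ℝ) (hV : ∀ τ : ℝ, V τ = (τ / γ) * ((2 : ℝ) ^ (D / (W * τ)) - 1))
    (F : ℝ → ℝ)
    (hF : ∀ τ₀ : ℝ, D * Real.log 2 / (W * γ) < τ₀ → 0 < F τ₀ ∧ V (F τ₀) = τ₀) :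
    StrictAntiOn F (Set.Ioi (D * Real.log 2 / (W * γ))) ∧
    ConvexOn ℝ (Set.Ioi (D * Real.log 2 / (W * γ))) F := by
  have hc : 0 < Real.log 2 * D / W := by
    have := Real.log_pos one_lt_two
    positivity
  have hV' (τ : ℝ) : γ * V τ = τ * (Real.exp (Real.log 2 * D / W / τ) - 1) := by
    rw [hV, Real.rpow_def_of_pos two_pos, ← mul_div_assoc, div_div]
    field_simp
  have support {b : ℝ} (hb : D * Real.log 2 / (W * γ) < b) :
      ∃ m < 0, ∀ a, D * Real.log 2 / (W * γ) < a → γ * b + m * (F a - F b) ≤ γ * a := by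
    obtain ⟨m, hm, h⟩ := exists_neg_slope_le_mul_exp_div_sub_one hc (hF b hb).1
    refine ⟨m, hm, fun a ha => ?_⟩
    have h' := h (F a) (hF a ha).1
    rwa [← hV', ← hV', (hF a ha).2, (hF b hb).2] at h'
  refine ⟨fun a ha b hb hab => ?_, convex_Ioi _, fun a ha b hb p q hp hq hpq => ?_⟩
  · obtain ⟨m, hm, h⟩ := support hb
    by_contra! hle
    nlinarith [h a ha, mul_lt_mul_of_pos_left hab hγ]
  · obtain ⟨m, hm, h⟩ := support (convex_Ioi _ ha hb hp hq hpq)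
    simp only [smul_eq_mul] at h ⊢
    have h₁ := mul_le_mul_of_nonneg_left (h a ha) hp
    have h₂ := mul_le_mul_of_nonneg_left (h b hb) hq
    obtain rfl : q = 1 - p := by linarith
    by_contra! hlt
    nlinarith [mul_pos_of_neg_of_neg hm (sub_neg.mpr hlt)]
end

section
/- Let x* > 0 be the unique positive real with e^{x*}·(1 − x*) = 1 − γ, and set τ* = D·ln 2/(W·x*). Then τ* is the global minimizer over (0, ∞) of the function τ ↦ τ + V(τ): for every τ > 0 one has τ + V(τ) ≥ τ* + V(τ*), with equality only at τ = τ*. Moreover the corresponding optimal energy-harvesting time equals V(τ*) = (D·ln 2/(W·x*·γ))·(e^{x*} − 1). -/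
/-- With x* > 0 the unique positive root of e^{x}(1 − x) = 1 − γ and
τ* = D·ln 2/(W·x*), τ* is the global minimizer of τ ↦ τ + V(τ) on (0,∞), equality
only at τ = τ*, and V(τ*) = (D·ln 2/(W·x*·γ))·(e^{x*} − 1). -/
theorem optimal_single_source (D W γ : ℝ) (hD : 0 < D) (hW : 0 < W) (hγ : 0 < γ)
    (V : ℝ → ℝ) (hV : ∀ τ : ℝ, V τ = (τ / γ) * ((2 : ℝ) ^ (D / (W * τ)) - 1))
    (xs : ℝ) (hxs : 0 < xs) (hroot : Real.exp xs * (1 - xs) = 1 - γ)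
    (τs : ℝ) (hτs : τs = D * Real.log 2 / (W * xs)) :
    (∀ τ : ℝ, 0 < τ → τs + V τs ≤ τ + V τ) ∧
    (∀ τ : ℝ, 0 < τ → τ + V τ = τs + V τs → τ = τs) ∧
    V τs = (D * Real.log 2 / (W * xs * γ)) * (Real.exp xs - 1) := by
  have hc : 0 < D * Real.log 2 / W := div_pos (mul_pos hD (Real.log_pos one_lt_two)) hW
  set c := D * Real.log 2 / W with hc_def
  have hpow (τ : ℝ) : (2 : ℝ) ^ (D / (W * τ)) = Real.exp (c / τ) := by
    rw [Real.rpow_def_of_pos two_pos, hc_def, div_div, mul_div_assoc', mul_comm D]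
  have hτs' : τs = c / xs := by rw [hτs, hc_def, div_div]
  have hτs_div : c / τs = xs := by rw [hτs', div_div_cancel₀ hc.ne']
  have hVs : V τs = (D * Real.log 2 / (W * xs * γ)) * (Real.exp xs - 1) := by
    rw [hV, hpow, hτs_div, hτs, div_div]
  have hmin : τs + V τs = c * Real.exp xs / γ := by
    rw [hV, hpow, hτs_div, hτs']
    field_simp
    linarith
  have hgap (τ : ℝ) (hτ : 0 < τ) : τ + V τ - (τs + V τs) =
      τ * Real.exp xs / γ * (Real.exp (c / τ - xs) - (c / τ - xs + 1)) := by
    have hnum : τ + V τ = τ / γ * (Real.exp xs * (xs - 1) + Real.exp (c / τ)) := by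
      rw [hV, hpow]
      field_simp
      linarith
    rw [hmin, hnum, Real.exp_sub]
    field_simp
    ring
  have hcoef (τ : ℝ) (hτ : 0 < τ) : 0 < τ * Real.exp xs / γ := by positivity
  refine ⟨fun τ hτ => ?_, fun τ hτ heq => ?_, hVs⟩
  · rw [← sub_nonneg, hgap τ hτ]
    exact mul_nonneg (hcoef τ hτ).le (sub_nonneg.2 (Real.add_one_le_exp _))
  · by_contra hne
    have hx : c / τ - xs ≠ 0 := by
      intro h
      rw [hτs', ← sub_eq_zero.1 h, div_div_cancel₀ hc.ne'] at hne
      exact hne rfl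
    have hpos := mul_pos (hcoef τ hτ) (sub_pos.2 (Real.add_one_lt_exp hx))
    rw [← hgap τ hτ, heq, sub_self] at hpos
    exact hpos.false
end

section
/- Let x* > 0 be the unique positive real with e^{x*}·(1 − x*) = 1 − γ, let τ* = D·ln 2/(W·x*), and let τ̈ > 0 be any real number. Then the minimum of τ + V(τ) over the interval [τ̈, ∞) is attained at m = max(τ*, τ̈): for every τ ≥ τ̈ one has τ + V(τ) ≥ m + V(m). -/
/-- On `[0, ∞)` the function `x ↦ e^x (x - 1)` is monotone. -/
theorem exp_mul_sub_one_le {a b : ℝ} (ha : 0 ≤ a) (hab : a ≤ b) :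
    Real.exp a * (a - 1) ≤ Real.exp b * (b - 1) := by
  have hb := Real.exp_pos b
  rcases le_total a 1 with h1 | h1
  · have htangent : Real.exp b * (1 + a - b) ≤ Real.exp a := by
      have h : Real.exp a = Real.exp b * Real.exp (a - b) := by
        rw [← Real.exp_add]; ring_nf
      rw [h]
      exact mul_le_mul_of_nonneg_left (by linarith [Real.add_one_le_exp (a - b)]) hb.le
    have h2 := mul_le_mul_of_nonneg_right htangent (sub_nonneg.2 h1)
    have h3 := mul_nonneg hb.le (mul_nonneg ha (sub_nonneg.2 hab))
    linarith
  · exact mul_le_mul (Real.exp_le_exp.2 hab) (by linarith) (by linarith) hb.le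

/-- The tangent-line inequality at `m` for the convex function `t ↦ t (k + e^{c/t})`. -/
theorem perspective_exp_tangent_le (c k : ℝ) {m t : ℝ} (hm : 0 < m) (ht : 0 < t) :
    m * (k + Real.exp (c / m)) + (t - m) * (k - Real.exp (c / m) * (c / m - 1)) ≤
      t * (k + Real.exp (c / t)) := by
  have h : Real.exp (c / m) * (1 + c / t - c / m) ≤ Real.exp (c / t) := by
    have h : Real.exp (c / t) = Real.exp (c / m) * Real.exp (c / t - c / m) := by
      rw [← Real.exp_add]; ring_nf
    rw [h]
    exact mul_le_mul_of_nonneg_left (by linarith [Real.add_one_le_exp (c / t - c / m)])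
      (Real.exp_pos _).le
  have h2 := mul_le_mul_of_nonneg_left h ht.le
  have hmc : m * (c / m) = c := mul_div_cancel₀ c hm.ne'
  have htc : t * (c / t) = c := mul_div_cancel₀ c ht.ne'
  linear_combination h2 + Real.exp (c / m) * (hmc - htc)

/-- With x* > 0 the unique positive root of e^{x}(1 − x) = 1 − γ,
τ* = D·ln 2/(W·x*) and any τ̈ > 0, the minimum of τ + V(τ) over [τ̈, ∞) is attained
at m = max(τ*, τ̈): for every τ ≥ τ̈, τ + V(τ) ≥ m + V(m). -/
theorem constrained_min_at_max (D W γ : ℝ) (hD : 0 < D) (hW : 0 < W) (hγ : 0 < γ)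
    (V : ℝ → ℝ) (hV : ∀ τ : ℝ, V τ = (τ / γ) * ((2 : ℝ) ^ (D / (W * τ)) - 1))
    (xs : ℝ) (hxs : 0 < xs) (hroot : Real.exp xs * (1 - xs) = 1 - γ)
    (τs : ℝ) (hτs : τs = D * Real.log 2 / (W * xs))
    (τdd : ℝ) (hτdd : 0 < τdd) :
    ∀ τ : ℝ, τdd ≤ τ → max τs τdd + V (max τs τdd) ≤ τ + V τ := by
  intro τ hτ
  set c := D * Real.log 2 / W with hc
  have hc0 : 0 < c := by have := Real.log_pos one_lt_two; positivity
  have hτs' : τs = c / xs := by rw [hτs, hc, div_div]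
  have hform : ∀ t : ℝ, t + V t = t * (γ - 1 + Real.exp (c / t)) / γ := by
    intro t
    rw [hV, Real.rpow_def_of_pos two_pos,
      show Real.log 2 * (D / (W * t)) = c / t by rw [hc, div_div]; ring]
    field_simp
    ring
  set m := max τs τdd with hm
  have hm0 : 0 < m := hτdd.trans_le (le_max_right _ _)
  have hslope : 0 ≤ (τ - m) * (γ - 1 - Real.exp (c / m) * (c / m - 1)) := by
    rcases le_total τdd τs with h | h
    · have hms : c / m = xs := by
        rw [hm, max_eq_left h, hτs', div_div_cancel₀ hc0.ne']
      rw [hms]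
      exact le_of_eq (by linear_combination (m - τ) * hroot)
    · have hmd : m = τdd := max_eq_right h
      have hle : c / m ≤ xs := by
        rw [div_le_comm₀ hm0 hxs, ← hτs', hmd]
        exact h
      have := exp_mul_sub_one_le (div_pos hc0 hm0).le hle
      exact mul_nonneg (by linarith) (by linarith)
  rw [hform, hform]
  refine div_le_div_of_nonneg_right ?_ hγ.le
  linarith [perspective_exp_tangent_le c (γ - 1) hm0 (hτdd.trans_le hτ)]
end

section
/- Let W, c, D be positive reals. The set {(τ₀, τ) ∈ ℝ² : τ > 0, τ₀ ≥ 0, and τ·W·log₂(1 + c·τ₀/τ) ≥ D} is a convex subset of ℝ². -/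
/-- Joint concavity of the perspective `(x, s) ↦ s * log (1 + c * x / s)` of the logarithm. -/
theorem perspective_log_concave {c x y s t a b : ℝ} (hc : 0 ≤ c) (hx : 0 ≤ x) (hy : 0 ≤ y)
    (hs : 0 < s) (ht : 0 < t) (ha : 0 ≤ a) (hb : 0 ≤ b) (hT : 0 < a * s + b * t) :
    a * (s * Real.log (1 + c * x / s)) + b * (t * Real.log (1 + c * y / t)) ≤
      (a * s + b * t) * Real.log (1 + c * (a * x + b * y) / (a * s + b * t)) := by
  have hu : 0 < 1 + c * x / s := by positivity
  have hv : 0 < 1 + c * y / t := by positivity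
  have key := strictConcaveOn_log_Ioi.concaveOn.2 (Set.mem_Ioi.2 hu) (Set.mem_Ioi.2 hv)
    (show 0 ≤ a * s / (a * s + b * t) by positivity)
    (show 0 ≤ b * t / (a * s + b * t) by positivity) (by field_simp)
  simp only [smul_eq_mul] at key
  have harg : a * s / (a * s + b * t) * (1 + c * x / s) +
      b * t / (a * s + b * t) * (1 + c * y / t) =
      1 + c * (a * x + b * y) / (a * s + b * t) := by
    field_simp
    ring
  rw [harg] at key
  calc _ = (a * s + b * t) * (a * s / (a * s + b * t) * Real.log (1 + c * x / s) +
        b * t / (a * s + b * t) * Real.log (1 + c * y / t)) := by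
        field_simp
    _ ≤ _ := mul_le_mul_of_nonneg_left key hT.le

/-- For positive W, c, D, the set
{(τ₀, τ) : τ > 0, τ₀ ≥ 0, τ·W·log₂(1 + c·τ₀/τ) ≥ D} is convex in ℝ². -/
theorem feasible_region_convex (W c D : ℝ) (hW : 0 < W) (hc : 0 < c) (hD : 0 < D) :
    Convex ℝ {p : ℝ × ℝ | 0 < p.2 ∧ 0 ≤ p.1 ∧
      D ≤ p.2 * W * Real.logb 2 (1 + c * p.1 / p.2)} := by
  rintro ⟨x, s⟩ ⟨hs, hx, hDx⟩ ⟨y, t⟩ ⟨ht, hy, hDy⟩ a b ha hb hab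
  simp only [Set.mem_ofPred_eq, Prod.smul_mk, Prod.mk_add_mk, smul_eq_mul] at *
  have hT : 0 < a * s + b * t := by
    simpa using convex_Ioi (0 : ℝ) (Set.mem_Ioi.2 hs) (Set.mem_Ioi.2 ht) ha hb hab
  refine ⟨hT, by positivity, ?_⟩
  have hk : 0 ≤ W / Real.log 2 := by positivity
  have key := mul_le_mul_of_nonneg_left
    (perspective_log_concave hc.le hx hy hs ht ha hb hT) hk
  have hcomb := add_le_add (mul_le_mul_of_nonneg_left hDx ha) (mul_le_mul_of_nonneg_left hDy hb)
  rw [← add_mul, hab, one_mul] at hcomb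
  simp only [Real.logb] at hcomb ⊢
  refine hcomb.trans (le_trans (le_of_eq ?_) (key.trans (le_of_eq ?_))) <;> ring
end

section
/- Let g, ζ, P_A, h, W, N₀, D, P^max be positive reals, set γ = g·ζ·P_A·h/(W·N₀), τ̈ = D/(W·log₂(1 + P^max·g/(W·N₀))) and τ̈₀ = P^max·τ̈/(ζ·P_A·h). For a fixed energy-harvesting time τ̄₀ > 0, let S(τ̄₀) = {τ > 0 : ∃ P, 0 ≤ P ≤ P^max ∧ P·τ ≤ ζ·P_A·h·τ̄₀ ∧ τ·W·log₂(1 + P·g/(W·N₀)) ≥ D}. Then: (i) if τ̄₀ ≥ τ̈₀, the minimum of S(τ̄₀) equals τ̈; (ii) if D·ln 2/(W·γ) < τ̄₀ < τ̈₀, the minimum of S(τ̄₀) equals the unique τ > 0 satisfying (τ/γ)(2^{D/(Wτ)} − 1) = τ̄₀. -/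
open Set

theorem strictAntiOn_mul_exp_div_sub_one {a : ℝ} (ha : 0 < a) :
    StrictAntiOn (fun τ : ℝ => τ * (Real.exp (a / τ) - 1)) (Ioi 0) := by
  intro s hs t ht hst
  rw [mem_Ioi] at hs ht
  have hne : a / s ≠ 0 := by positivity
  have hlt : s / t < 1 := (div_lt_one ht).2 hst
  have hconv := strictConvexOn_exp.2 (mem_univ (a / s)) (mem_univ 0) hne
    (div_pos hs ht) (sub_pos.2 hlt) (by ring)
  simp only [smul_eq_mul, mul_zero, add_zero, Real.exp_zero, mul_one] at hconv
  have hcomb : s / t * (a / s) = a / t := by field_simp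
  rw [hcomb] at hconv
  have hmul := mul_lt_mul_of_pos_left hconv ht
  have hexpand : t * (s / t * Real.exp (a / s) + (1 - s / t))
      = s * Real.exp (a / s) + (t - s) := by field_simp
  change t * (Real.exp (a / t) - 1) < s * (Real.exp (a / s) - 1)
  linarith

theorem continuousOn_mul_exp_div_sub_one (a : ℝ) :
    ContinuousOn (fun τ : ℝ => τ * (Real.exp (a / τ) - 1)) (Ioi 0) := by
  refine continuousOn_id.mul (ContinuousOn.sub ?_ continuousOn_const)
  exact (continuousOn_const.div continuousOn_id fun x hx => (mem_Ioi.1 hx).ne').rexp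

theorem exists_mul_exp_div_sub_one_lt {a K : ℝ} (ha : 0 < a) (hK : a < K) (t : ℝ) :
    ∃ τ, t < τ ∧ 0 < τ ∧ τ * (Real.exp (a / τ) - 1) < K := by
  have hKa : 0 < K - a := sub_pos.2 hK
  obtain ⟨τ, hτ⟩ := exists_gt (max (max t a) (K * a / (K - a)))
  obtain ⟨hτ', hτK⟩ := max_lt_iff.1 hτ
  obtain ⟨hτt, hτa⟩ := max_lt_iff.1 hτ'
  have hpos : 0 < τ := ha.trans hτa
  refine ⟨τ, hτt, hpos, ?_⟩
  rw [div_lt_iff₀ hKa] at hτK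
  have hexp : (τ - a) * Real.exp (a / τ) ≤ τ := by
    have hle := mul_le_mul_of_nonneg_right (Real.one_sub_le_exp_neg (a / τ))
      (Real.exp_pos (a / τ)).le
    rw [← Real.exp_add, neg_add_cancel, Real.exp_zero] at hle
    calc (τ - a) * Real.exp (a / τ) = τ * ((1 - a / τ) * Real.exp (a / τ)) := by field_simp
      _ ≤ τ * 1 := mul_le_mul_of_nonneg_left hle hpos.le
      _ = τ := mul_one τ
  have hsub : 0 < τ - a := sub_pos.2 hτa
  have hbound : (τ - a) * (τ * (Real.exp (a / τ) - 1)) < (τ - a) * K := by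
    nlinarith [mul_le_mul_of_nonneg_left hexp hpos.le]
  exact lt_of_mul_lt_mul_left hbound hsub.le

/-- The power needed to deliver the data in time `τ` is `c * (exp (a / τ) - 1)`. -/
theorem le_mul_logb_two_iff {W D c P τ : ℝ} (hW : 0 < W) (hc : 0 < c) (hP : 0 ≤ P)
    (hτ : 0 < τ) :
    D ≤ τ * W * Real.logb 2 (1 + P / c) ↔
      c * (Real.exp (D * Real.log 2 / W / τ) - 1) ≤ P := by
  have hlog : 0 < Real.log 2 := Real.log_pos one_lt_two
  have harg : 0 < 1 + P / c := by positivity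
  have hdemand : D ≤ τ * W * Real.logb 2 (1 + P / c) ↔
      D * Real.log 2 / W / τ ≤ Real.log (1 + P / c) := by
    rw [Real.logb, ← mul_div_assoc, le_div_iff₀ hlog, div_div, div_le_iff₀ (by positivity)]
    constructor <;> intro H <;> linarith
  rw [hdemand, Real.le_log_iff_exp_le harg, ← sub_le_iff_le_add', le_div_iff₀ hc, mul_comm c]


/-- For a fixed energy-harvesting time τ̄₀ > 0, with
S(τ̄₀) = {τ > 0 : ∃ P, 0 ≤ P ≤ P^max ∧ P·τ ≤ ζ·P_A·h·τ̄₀ ∧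
τ·W·log₂(1 + P·g/(W·N₀)) ≥ D}: (i) if τ̄₀ ≥ τ̈₀ the minimum of S(τ̄₀) is τ̈;
(ii) if D·ln 2/(W·γ) < τ̄₀ < τ̈₀ the minimum of S(τ̄₀) is the unique τ > 0 with
(τ/γ)(2^{D/(Wτ)} − 1) = τ̄₀. -/
theorem subproblem_solution (g ζ PA h W N₀ D Pmax : ℝ)
    (hg : 0 < g) (hζ : 0 < ζ) (hPA : 0 < PA) (hh : 0 < h) (hW : 0 < W)
    (hN₀ : 0 < N₀) (hD : 0 < D) (hPmax : 0 < Pmax)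
    (γ : ℝ) (hγ : γ = g * ζ * PA * h / (W * N₀))
    (τdd : ℝ) (hτdd : τdd = D / (W * Real.logb 2 (1 + Pmax * g / (W * N₀))))
    (τdd₀ : ℝ) (hτdd₀ : τdd₀ = Pmax * τdd / (ζ * PA * h))
    (τ₀ : ℝ) (hτ₀ : 0 < τ₀)
    (S : Set ℝ)
    (hS : S = {τ : ℝ | 0 < τ ∧ ∃ P : ℝ, 0 ≤ P ∧ P ≤ Pmax ∧ P * τ ≤ ζ * PA * h * τ₀ ∧
        D ≤ τ * W * Real.logb 2 (1 + P * g / (W * N₀))}) :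
    (τdd₀ ≤ τ₀ → IsLeast S τdd) ∧
    (D * Real.log 2 / (W * γ) < τ₀ → τ₀ < τdd₀ →
      (∃! τ : ℝ, 0 < τ ∧ (τ / γ) * ((2 : ℝ) ^ (D / (W * τ)) - 1) = τ₀) ∧
      (∀ τ : ℝ, 0 < τ → (τ / γ) * ((2 : ℝ) ^ (D / (W * τ)) - 1) = τ₀ →
        IsLeast S τ)) := by
  set c : ℝ := W * N₀ / g with hc_def
  set a : ℝ := D * Real.log 2 / W with ha_def
  set f : ℝ → ℝ := fun τ => τ * (Real.exp (a / τ) - 1) with hf_def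
  have hlog : 0 < Real.log 2 := Real.log_pos one_lt_two
  have hc : 0 < c := by positivity
  have ha : 0 < a := by positivity
  have hγpos : 0 < γ := by rw [hγ]; positivity
  have hγc : γ * c = ζ * PA * h := by rw [hγ, hc_def]; field_simp
  have hratio (P : ℝ) : P * g / (W * N₀) = P / c := by rw [hc_def]; field_simp
  have hanti : StrictAntiOn f (Ioi 0) := strictAntiOn_mul_exp_div_sub_one ha
  have hpow (τ : ℝ) : (τ / γ) * ((2 : ℝ) ^ (D / (W * τ)) - 1) = τ₀ ↔ f τ = γ * τ₀ := by
    have harg : Real.log 2 * (D / (W * τ)) = a / τ := by rw [ha_def, div_div]; ring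
    rw [Real.rpow_def_of_pos two_pos, harg, div_mul_eq_mul_div, div_eq_iff hγpos.ne', mul_comm γ]
  have hmem (τ : ℝ) : τ ∈ S ↔ 0 < τ ∧ c * (Real.exp (a / τ) - 1) ≤ Pmax ∧ f τ ≤ γ * τ₀ := by
    rw [hS, mem_ofPred_eq]
    refine and_congr_right fun hτ => ?_
    have henergy : c * (Real.exp (a / τ) - 1) * τ ≤ ζ * PA * h * τ₀ ↔ f τ ≤ γ * τ₀ := by
      rw [← hγc]
      have hleft : c * (Real.exp (a / τ) - 1) * τ = c * f τ := by simp only [hf_def]; ring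
      have hright : γ * c * τ₀ = c * (γ * τ₀) := by ring
      rw [hleft, hright, mul_le_mul_iff_right₀ hc]
    have hnonneg : 0 ≤ c * (Real.exp (a / τ) - 1) :=
      mul_nonneg hc.le (sub_nonneg.2 (Real.one_le_exp (by positivity)))
    rw [← henergy]
    constructor
    · rintro ⟨P, hP, hPm, hE, hdata⟩
      rw [hratio, le_mul_logb_two_iff hW hc hP hτ] at hdata
      exact ⟨hdata.trans hPm, (mul_le_mul_of_nonneg_right hdata hτ.le).trans hE⟩
    · rintro ⟨hPm, hE⟩
      refine ⟨_, hnonneg, hPm, hE, ?_⟩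
      rw [hratio, le_mul_logb_two_iff hW hc hnonneg hτ]
  have hL : 0 < Real.log (1 + Pmax / c) :=
    Real.log_pos (by linarith [div_pos hPmax hc])
  have hτdd_eq : τdd = a / Real.log (1 + Pmax / c) := by
    rw [hτdd, hratio, Real.logb, ha_def]
    field_simp
  have hτdd_pos : 0 < τdd := by rw [hτdd_eq]; exact div_pos ha hL
  have hpower (τ : ℝ) (hτ : 0 < τ) : c * (Real.exp (a / τ) - 1) ≤ Pmax ↔ τdd ≤ τ := by
    rw [← le_div_iff₀' hc, sub_le_iff_le_add', ← Real.le_log_iff_exp_le (by positivity),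
      hτdd_eq, div_le_comm₀ hτ hL]
  have hτdd_power : c * (Real.exp (a / τdd) - 1) = Pmax := by
    rw [hτdd_eq, div_div_cancel₀ ha.ne', Real.exp_log (by positivity)]
    field_simp
    ring
  have hfdd : f τdd = γ * τdd₀ := by
    rw [hτdd₀, ← hγc, ← hτdd_power]
    simp only [hf_def]
    field_simp
  refine ⟨fun hle => ⟨?_, fun τ hτ => ?_⟩, fun hlow hhigh => ?_⟩
  · exact (hmem _).2 ⟨hτdd_pos, hτdd_power.le, hfdd ▸ mul_le_mul_of_nonneg_left hle hγpos.le⟩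
  · obtain ⟨hpos, hP, -⟩ := (hmem τ).1 hτ
    exact (hpower τ hpos).1 hP
  have hupper : γ * τ₀ < f τdd := hfdd ▸ mul_lt_mul_of_pos_left hhigh hγpos
  have hlower : a < γ * τ₀ := by
    rw [← div_div, div_lt_iff₀ hγpos] at hlow
    linarith
  simp only [hpow]
  refine ⟨?_, fun τ hτ hroot => ⟨(hmem τ).2 ⟨hτ, (hpower τ hτ).2 ?_, hroot.le⟩, fun σ hσ => ?_⟩⟩
  · obtain ⟨t, hlt, -, hft⟩ := exists_mul_exp_div_sub_one_lt ha hlower τdd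
    obtain ⟨τ, hτ, hroot⟩ := intermediate_value_Icc' hlt.le
      ((continuousOn_mul_exp_div_sub_one a).mono fun x hx => hτdd_pos.trans_le hx.1)
      ⟨hft.le, hupper.le⟩
    have hτ_pos : 0 < τ := hτdd_pos.trans_le hτ.1
    exact ⟨τ, ⟨hτ_pos, hroot⟩, fun σ hσ => hanti.injOn hσ.1 hτ_pos (hσ.2.trans hroot.symm)⟩
  · exact ((hanti.lt_iff_gt hτ hτdd_pos).1 (hroot.trans_lt hupper)).le
  · obtain ⟨hpos, -, hE⟩ := (hmem σ).1 hσ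
    exact (hanti.le_iff_ge hpos hτ).1 (hE.trans hroot.ge)
end

section
/- Let 0 < γ₁ < γ₂, and for i = 1, 2 let x_i > 0 be the unique positive real with e^{x_i}·(1 − x_i) = 1 − γ_i. Fix D > 0 and W > 0 and set τ_i = D·ln 2/(W·x_i) and τ₀ᵢ = (τ_i/γ_i)·(2^{D/(W·τ_i)} − 1). Then x₁ < x₂, hence τ₂ < τ₁, and moreover τ₀₂ < τ₀₁; that is, both the optimal information-transmission time and the optimal energy-harvesting time of a single source are strictly decreasing functions of γ. -/
/-- The function `x ↦ exp x * (1 - x)` is antitone on the nonnegative reals. -/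
lemma antitoneOn_exp_mul_one_sub :
    AntitoneOn (fun x : ℝ => Real.exp x * (1 - x)) (Set.Ici 0) := by
  intro a ha b _ hab
  have ha : 0 ≤ a := ha
  show Real.exp b * (1 - b) ≤ Real.exp a * (1 - a)
  rcases le_total a 1 with h1 | h1
  · have hexp : Real.exp a = Real.exp b * Real.exp (a - b) := by
      rw [← Real.exp_add]; congr 1; ring
    have hlin : a - b + 1 ≤ Real.exp (a - b) := Real.add_one_le_exp _
    rw [hexp, mul_assoc]
    refine mul_le_mul_of_nonneg_left ?_ (Real.exp_pos b).le
    nlinarith [mul_le_mul_of_nonneg_right hlin (sub_nonneg.2 h1),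
      mul_nonneg ha (sub_nonneg.2 hab)]
  · have hexp : Real.exp a ≤ Real.exp b := Real.exp_le_exp.2 hab
    nlinarith [mul_le_mul_of_nonneg_right hexp (sub_nonneg.2 h1),
      mul_le_mul_of_nonneg_left hab (Real.exp_pos b).le]

/-- Monotonicity of `x ↦ x / (1 - exp (-x))` on the positive reals, with denominators cleared. -/
lemma mul_exp_mul_exp_sub_one_le {a b : ℝ} (ha : 0 ≤ a) (hb : 0 < b) (hab : a ≤ b) :
    a * Real.exp a * (Real.exp b - 1) ≤ b * Real.exp b * (Real.exp a - 1) := by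
  have hconv := convexOn_exp.2 (Set.mem_univ (0 : ℝ)) (Set.mem_univ (-b))
    (sub_nonneg.2 ((div_le_one hb).2 hab)) (div_nonneg ha hb.le) (sub_add_cancel 1 (a / b))
  have hpt : (1 - a / b) • (0 : ℝ) + (a / b) • (-b) = -a := by
    simp only [smul_eq_mul]; field_simp; ring
  rw [hpt, Real.exp_zero, Real.exp_neg, Real.exp_neg] at hconv
  simp only [smul_eq_mul] at hconv
  have hA := Real.exp_pos a
  have hB := Real.exp_pos b
  have hmul := mul_le_mul_of_nonneg_left hconv (mul_pos hb (mul_pos hA hB)).le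
  have hl : b * (Real.exp a * Real.exp b) * (Real.exp a)⁻¹ = b * Real.exp b := by
    field_simp
  have hr : b * (Real.exp a * Real.exp b) *
      ((1 - a / b) * 1 + a / b * (Real.exp b)⁻¹) =
      (b - a) * (Real.exp a * Real.exp b) + a * Real.exp a := by
    field_simp
  rw [hl, hr] at hmul
  linarith

/-- The optimal energy-harvesting time expressed through the root `x`. -/
lemma harvesting_time_eq {D W x : ℝ} (γ : ℝ) (hD : 0 < D) (hW : 0 < W) (hx : 0 < x) :
    D * Real.log 2 / (W * x) / γ * ((2 : ℝ) ^ (D / (W * (D * Real.log 2 / (W * x)))) - 1) =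
      D * Real.log 2 / W * ((Real.exp x - 1) / (x * γ)) := by
  have hlog : 0 < Real.log 2 := Real.log_pos one_lt_two
  have hpow : (2 : ℝ) ^ (D / (W * (D * Real.log 2 / (W * x)))) = Real.exp x := by
    rw [Real.rpow_def_of_pos two_pos]
    congr 1
    field_simp
  rw [hpow, div_div, div_mul_div_comm, div_mul_eq_mul_div, mul_assoc W]

/-- For 0 < γ₁ < γ₂ with xᵢ > 0 the unique positive roots of
e^{x}(1 − x) = 1 − γᵢ, τᵢ = D·ln 2/(W·xᵢ) and τ₀ᵢ = (τᵢ/γᵢ)(2^{D/(W·τᵢ)} − 1):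
x₁ < x₂, hence τ₂ < τ₁, and τ₀₂ < τ₀₁. -/
theorem optimal_times_decreasing_in_gamma (γ₁ γ₂ : ℝ) (hγ₁ : 0 < γ₁) (hγ : γ₁ < γ₂)
    (x₁ x₂ : ℝ) (hx₁ : 0 < x₁) (hr₁ : Real.exp x₁ * (1 - x₁) = 1 - γ₁)
    (hx₂ : 0 < x₂) (hr₂ : Real.exp x₂ * (1 - x₂) = 1 - γ₂)
    (D W : ℝ) (hD : 0 < D) (hW : 0 < W)
    (τ₁ τ₂ τ₀₁ τ₀₂ : ℝ)
    (hτ₁ : τ₁ = D * Real.log 2 / (W * x₁))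
    (hτ₂ : τ₂ = D * Real.log 2 / (W * x₂))
    (hτ₀₁ : τ₀₁ = (τ₁ / γ₁) * ((2 : ℝ) ^ (D / (W * τ₁)) - 1))
    (hτ₀₂ : τ₀₂ = (τ₂ / γ₂) * ((2 : ℝ) ^ (D / (W * τ₂)) - 1)) :
    x₁ < x₂ ∧ τ₂ < τ₁ ∧ τ₀₂ < τ₀₁ := by
  have hx : x₁ < x₂ := by
    by_contra! h
    have hle : Real.exp x₁ * (1 - x₁) ≤ Real.exp x₂ * (1 - x₂) :=
      antitoneOn_exp_mul_one_sub hx₂.le hx₁.le h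
    linarith
  have hlog : 0 < Real.log 2 := Real.log_pos one_lt_two
  refine ⟨hx, ?_, ?_⟩
  · rw [hτ₁, hτ₂]
    gcongr
  · rw [hτ₀₁, hτ₀₂, hτ₁, hτ₂, harvesting_time_eq γ₁ hD hW hx₁, harvesting_time_eq γ₂ hD hW hx₂]
    have hγ₂ : 0 < γ₂ := hγ₁.trans hγ
    refine mul_lt_mul_of_pos_left ?_ (by positivity)
    rw [div_lt_div_iff₀ (by positivity) (by positivity)]
    have hexp : 0 < Real.exp x₂ - 1 := sub_pos.2 (Real.one_lt_exp_iff.2 hx₂)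
    have hkey : γ₁ * (Real.exp x₂ - 1) ≤ γ₂ * (Real.exp x₁ - 1) := by
      rw [show γ₁ = 1 - Real.exp x₁ * (1 - x₁) by linarith,
        show γ₂ = 1 - Real.exp x₂ * (1 - x₂) by linarith]
      linarith [mul_exp_mul_exp_sub_one_le hx₁.le hx₂ hx.le]
    calc (Real.exp x₂ - 1) * (x₁ * γ₁) = x₁ * (γ₁ * (Real.exp x₂ - 1)) := by ring
      _ < x₂ * (γ₁ * (Real.exp x₂ - 1)) := mul_lt_mul_of_pos_right hx (mul_pos hγ₁ hexp)
      _ ≤ x₂ * (γ₂ * (Real.exp x₁ - 1)) := mul_le_mul_of_nonneg_left hkey hx₂.le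
      _ = (Real.exp x₁ - 1) * (x₂ * γ₂) := by ring
end
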